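/- Let G = ([n], E) be a natural unit interval graph, and for each j ∈ [n] let c_j = |{i < j : {i,j} ∈ E}|. Then for every natural number q, the number of proper colorings of G with colors from {1, …, q} equals Π_{j=1}^{n} (q − c_j), as an identity of integers; equivalently, the chromatic polynomial of G is χ_G(q) = Π_{j=1}^{n} (q − c_j). -/

import Mathlib

open Classical

/-- `G` is a natural unit interval graph: for every edge `{i,j}` with `i < j` and every
`i < k < j`, both `{i,k}` and `{k,j}` are edges. -/
def IsNaturalUnitIntervalGraph {n : ℕ} (G : SimpleGraph (Fin n)) : Prop :=
  ∀ i j k : Fin n, G.Adj i j → i < k → k < j → G.Adj i k ∧ G.Adj k j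

/-- Every descent of `σ` is a `G`-descent: whenever `σ_t > σ_{t+1}`,
`{σ_t, σ_{t+1}}` is an edge of `G`. -/
def AllDescentsGDescents {n : ℕ} (G : SimpleGraph (Fin n)) (σ : Equiv.Perm (Fin n)) : Prop :=
  ∀ (t : ℕ) (h : t + 1 < n), σ ⟨t + 1, h⟩ < σ ⟨t, Nat.lt_of_succ_lt h⟩ →
    G.Adj (σ ⟨t, Nat.lt_of_succ_lt h⟩) (σ ⟨t + 1, h⟩)

/-- A proper coloring on `n + 1` vertices is a proper coloring of the first `n` vertices together
with a color for the last vertex that avoids those of its neighbors. -/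
def properColoringSnocEquiv {n q : ℕ} (G : SimpleGraph (Fin (n + 1))) :
    {c : Fin (n + 1) → Fin q // ∀ a b, G.Adj a b → c a ≠ c b} ≃
      Σ c : {c : Fin n → Fin q // ∀ a b, (G.comap Fin.castSucc).Adj a b → c a ≠ c b},
        {x : Fin q // ∀ i : Fin n, G.Adj i.castSucc (Fin.last n) → c.1 i ≠ x} where
  toFun c := ⟨⟨fun i => c.1 i.castSucc, fun _ _ h => c.2 _ _ h⟩,
    ⟨c.1 (Fin.last n), fun _ h => c.2 _ _ h⟩⟩
  invFun p := ⟨Fin.snoc p.1.1 p.2.1, fun a b => by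
    induction a using Fin.lastCases with
    | last =>
      induction b using Fin.lastCases with
      | last => exact fun h => (G.irrefl h).elim
      | cast b => simpa using fun h => (p.2.2 b h.symm).symm
    | cast a =>
      induction b using Fin.lastCases with
      | last => simpa using p.2.2 a
      | cast b => simpa using p.1.2 a b⟩
  left_inv c := by
    ext a
    induction a using Fin.lastCases <;> simp
  right_inv p := by
    refine Sigma.subtype_ext (Subtype.ext (funext fun i => ?_)) ?_ <;> simp

theorem card_avoiding_colors {α : Type*} {q : ℕ} (s : Finset α) (c : α → Fin q)
    (hc : Set.InjOn c s) :
    (Nat.card {x : Fin q // ∀ i ∈ s, c i ≠ x} : ℤ) = q - s.card := by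
  have h : Nat.card {x : Fin q // ∀ i ∈ s, c i ≠ x} = ((s.image c)ᶜ).card := by
    rw [Nat.card_eq_fintype_card, Fintype.card_subtype]
    congr 1
    ext x
    simp
  have hle : s.card ≤ q := by
    simpa [Finset.card_image_of_injOn hc] using (s.image c).card_le_univ
  rw [h, Finset.card_compl, Finset.card_image_of_injOn hc, Fintype.card_fin, Nat.cast_sub hle]

theorem IsNaturalUnitIntervalGraph.comap_castSucc {n : ℕ} {G : SimpleGraph (Fin (n + 1))}
    (hG : IsNaturalUnitIntervalGraph G) :
    IsNaturalUnitIntervalGraph (G.comap Fin.castSucc) :=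
  fun i j k h hik hkj => hG i.castSucc j.castSucc k.castSucc h hik hkj

/-- The neighbors of the last vertex form a clique, so a proper coloring is injective on them. -/
theorem IsNaturalUnitIntervalGraph.injOn_neighbors_last {n : ℕ} {α : Type*}
    {G : SimpleGraph (Fin (n + 1))} (hG : IsNaturalUnitIntervalGraph G) {c : Fin n → α}
    (hc : ∀ a b, (G.comap Fin.castSucc).Adj a b → c a ≠ c b) :
    Set.InjOn c {i | G.Adj i.castSucc (Fin.last n)} := by
  intro a ha b hb hab
  rcases lt_trichotomy a b with h | h | h
  · exact (hc a b (hG _ _ _ ha h (Fin.castSucc_lt_last b)).1 hab).elim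
  · exact h
  · exact (hc b a (hG _ _ _ hb h (Fin.castSucc_lt_last a)).1 hab.symm).elim

theorem card_neighbors_below_castSucc {n : ℕ} (G : SimpleGraph (Fin (n + 1))) (j : Fin n) :
    (Finset.univ.filter fun i : Fin (n + 1) => i < j.castSucc ∧ G.Adj i j.castSucc).card =
      (Finset.univ.filter fun i : Fin n => i < j ∧ G.Adj i.castSucc j.castSucc).card := by
  conv_rhs => rw [← Finset.card_map Fin.castSuccEmb]
  refine congrArg Finset.card (Finset.ext fun i => ?_)
  induction i using Fin.lastCases with
  | last => simp [(Fin.castSucc_lt_last j).not_gt]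
  | cast i => simp

theorem card_neighbors_below_last {n : ℕ} (G : SimpleGraph (Fin (n + 1))) :
    (Finset.univ.filter fun i : Fin (n + 1) => i < Fin.last n ∧ G.Adj i (Fin.last n)).card =
      (Finset.univ.filter fun i : Fin n => G.Adj i.castSucc (Fin.last n)).card := by
  conv_rhs => rw [← Finset.card_map Fin.castSuccEmb]
  refine congrArg Finset.card (Finset.ext fun i => ?_)
  induction i using Fin.lastCases with
  | last => simp
  | cast i => simp [Fin.castSucc_lt_last]

/-- for a natural unit interval graph `G` with `c_j = #{i < j : {i,j} ∈ E}`,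
the number of proper `q`-colorings of `G` is `∏_{j=1}^n (q − c_j)`. -/
theorem chromatic_poly_NUI {n : ℕ} (G : SimpleGraph (Fin n))
    (hG : IsNaturalUnitIntervalGraph G) (q : ℕ) :
    (Nat.card {c : Fin n → Fin q // ∀ a b : Fin n, G.Adj a b → c a ≠ c b} : ℤ) =
      ∏ j : Fin n,
        ((q : ℤ) - ((Finset.univ.filter fun i : Fin n => i < j ∧ G.Adj i j).card : ℤ)) := by
  induction n with
  | zero =>
    have : Unique {c : Fin 0 → Fin q // ∀ a b : Fin 0, G.Adj a b → c a ≠ c b} :=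
      ⟨⟨⟨Fin.elim0, fun a => a.elim0⟩⟩, fun _ => Subsingleton.elim _ _⟩
    simp
  | succ n ih =>
    rw [Fin.prod_univ_castSucc, card_neighbors_below_last]
    simp only [card_neighbors_below_castSucc]
    have h := ih _ hG.comap_castSucc
    simp only [SimpleGraph.comap_adj] at h
    rw [← h, Nat.card_congr (properColoringSnocEquiv G), Nat.card_sigma,
      Nat.cast_sum, Finset.sum_congr rfl (g := fun _ => (q : ℤ) -
        (Finset.univ.filter fun i : Fin n => G.Adj i.castSucc (Fin.last n)).card)]
    · simp [mul_sub]
    · intro c _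
      simpa using card_avoiding_colors
        (Finset.univ.filter fun i : Fin n => G.Adj i.castSucc (Fin.last n)) c.1
        (by simpa using hG.injOn_neighbors_last c.2)
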